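/- arXiv:2507.17122 — 3 statements merged into one kernel-verified Lean document; each statement's English description precedes it below -/
import Mathlib

section
/- Let X be a nontrivial real Banach space and let τ, υ > 0. Then L^I_YJ(τ, υ, X) = (2(τ²+υ²)/υ²) · L′_YJ(τ, υ, X); equivalently, L′_YJ(τ, υ, X) = (υ²/(2(τ²+υ²))) · L^I_YJ(τ, υ, X). -/
noncomputable section

/-- Isosceles orthogonality: `x ⊥_I y` iff `‖x + y‖ = ‖x - y‖`. -/
def IsoOrth {X : Type*} [NormedAddCommGroup X] (x y : X) : Prop := ‖x + y‖ = ‖x - y‖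

variable (X : Type*) [NormedAddCommGroup X] [NormedSpace ℝ X]

/-- The constant `H̃(X)`. -/
def Htilde : ℝ :=
  sSup {r : ℝ | ∃ x y : X, (x, y) ≠ (0, 0) ∧ IsoOrth x y ∧ r = (‖x‖ + ‖y‖) / ‖x + y‖}

/-- The constant `A₂(X)`. -/
def A2 : ℝ :=
  sSup {r : ℝ | ∃ x y : X, ‖x‖ = 1 ∧ ‖y‖ = 1 ∧ r = (‖x + y‖ + ‖x - y‖) / 2}

/-- Clarkson's modulus of convexity `δ_X(ε)`. -/
def modulusConvexity (ε : ℝ) : ℝ :=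
  sInf {r : ℝ | ∃ x y : X, ‖x‖ ≤ 1 ∧ ‖y‖ ≤ 1 ∧ ε ≤ ‖x - y‖ ∧ r = 1 - ‖x + y‖ / 2}

/-- The constant `H̃²(X)`. -/
def HtildeSq : ℝ :=
  sSup {r : ℝ | ∃ x y : X, (x, y) ≠ (0, 0) ∧ IsoOrth x y ∧
    r = (‖x‖ ^ 2 + ‖y‖ ^ 2) / ‖x + y‖ ^ 2}

/-- The modified von Neumann–Jordan constant `C′_NJ(X)`. -/
def CNJmod : ℝ :=
  sSup {r : ℝ | ∃ x y : X, ‖x‖ = 1 ∧ ‖y‖ = 1 ∧ r = (‖x + y‖ ^ 2 + ‖x - y‖ ^ 2) / 4}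

/-- The von Neumann–Jordan constant `C_NJ(X)`. -/
def CNJ : ℝ :=
  sSup {r : ℝ | ∃ x y : X, (x, y) ≠ (0, 0) ∧
    r = (‖x + y‖ ^ 2 + ‖x - y‖ ^ 2) / (2 * ‖x‖ ^ 2 + 2 * ‖y‖ ^ 2)}

/-- The James constant in its isosceles-orthogonality form. -/
def JamesConst : ℝ :=
  sSup {r : ℝ | ∃ x y : X, ‖x‖ ≤ 1 ∧ ‖y‖ ≤ 1 ∧ IsoOrth x y ∧ r = ‖x + y‖}

/-- The constant `E_I(t, X)`. -/
def EI (t : ℝ) : ℝ :=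
  sSup {r : ℝ | ∃ x y : X, (x, y) ≠ (0, 0) ∧ IsoOrth x y ∧
    r = (‖(t + 1) • x + (1 - t) • y‖ ^ 2 + ‖(1 - t) • x - (t + 1) • y‖ ^ 2) / ‖x + y‖ ^ 2}

/-- The skew constant `E(t, X)`. -/
def Eskew (t : ℝ) : ℝ :=
  sSup {r : ℝ | ∃ x y : X, ‖x‖ = 1 ∧ ‖y‖ = 1 ∧ r = ‖x + t • y‖ ^ 2 + ‖t • x - y‖ ^ 2}

/-- The constant `L^I_YJ(τ, υ, X)`. -/
def LIYJ (τ υ : ℝ) : ℝ :=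
  sSup {r : ℝ | ∃ x y : X, (x, y) ≠ (0, 0) ∧ IsoOrth x y ∧
    r = (‖(τ + υ) • x + (υ - τ) • y‖ ^ 2 + ‖(υ - τ) • x - (τ + υ) • y‖ ^ 2) /
      (υ ^ 2 * ‖x + y‖ ^ 2)}

/-- The modified skew von Neumann–Jordan constant `L′_YJ(τ, υ, X)`. -/
def LYJmod (τ υ : ℝ) : ℝ :=
  sSup {r : ℝ | ∃ x y : X, ‖x‖ = 1 ∧ ‖y‖ = 1 ∧
    r = (‖τ • x + υ • y‖ ^ 2 + ‖υ • x - τ • y‖ ^ 2) / (2 * (τ ^ 2 + υ ^ 2))}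

end

/-- `L^I_YJ(τ, υ, X) = (2(τ²+υ²)/υ²) · L′_YJ(τ, υ, X)`. -/
theorem stmt15 (X : Type*) [NormedAddCommGroup X] [NormedSpace ℝ X] [CompleteSpace X]
    [Nontrivial X] (τ υ : ℝ) (hτ : 0 < τ) (hυ : 0 < υ) :
    LIYJ X τ υ = 2 * (τ ^ 2 + υ ^ 2) / υ ^ 2 * LYJmod X τ υ := by
  unfold LIYJ LYJmod
  open scoped Pointwise in
  rw [← smul_eq_mul, ← Real.sSup_smul_of_nonneg (by positivity)]
  congr 1
  ext r
  rw [Set.mem_smul_set]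
  constructor
  · rintro ⟨x, y, hxy, hI, rfl⟩
    have hI : ‖x + y‖ = ‖x - y‖ := hI
    have ha : ‖x + y‖ ≠ 0 := by
      intro h0
      have h1 : x + y = 0 := norm_eq_zero.1 h0
      have h2 : x = y := sub_eq_zero.1 (norm_eq_zero.1 (hI ▸ h0))
      have hy : y = 0 := by
        subst h2
        rw [← two_smul ℝ] at h1
        exact (smul_eq_zero.1 h1).resolve_left two_ne_zero
      exact hxy (by rw [h2, hy])
    have key (p q : ℝ) : ‖p • ‖x + y‖⁻¹ • (x - y) + q • ‖x + y‖⁻¹ • (x + y)‖ =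
        ‖(p + q) • x + (q - p) • y‖ / ‖x + y‖ := by
      have : p • ‖x + y‖⁻¹ • (x - y) + q • ‖x + y‖⁻¹ • (x + y) =
          ‖x + y‖⁻¹ • ((p + q) • x + (q - p) • y) := by module
      rw [this, norm_smul, norm_inv, norm_norm, div_eq_inv_mul]
    have h₂ := key υ (-τ)
    rw [neg_smul, ← sub_eq_add_neg,
      show (υ + -τ) • x + (-τ - υ) • y = (υ - τ) • x - (τ + υ) • y by module] at h₂
    refine ⟨_, ⟨‖x + y‖⁻¹ • (x - y), ‖x + y‖⁻¹ • (x + y), ?_, ?_, rfl⟩, ?_⟩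
    · rw [norm_smul, norm_inv, norm_norm, ← hI, inv_mul_cancel₀ ha]
    · rw [norm_smul, norm_inv, norm_norm, inv_mul_cancel₀ ha]
    · rw [key τ υ, h₂, smul_eq_mul]
      field_simp
  · rintro ⟨_, ⟨x, y, hx, hy, rfl⟩, rfl⟩
    have hsum : (2⁻¹ : ℝ) • (y + x) + (2⁻¹ : ℝ) • (y - x) = y := by module
    have hdiff : (2⁻¹ : ℝ) • (y + x) - (2⁻¹ : ℝ) • (y - x) = x := by module
    refine ⟨(2⁻¹ : ℝ) • (y + x), (2⁻¹ : ℝ) • (y - x), ?_, ?_, ?_⟩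
    · intro h
      obtain ⟨h1, h2⟩ := Prod.mk.inj h
      rw [h1, h2, add_zero] at hsum
      simp [← hsum] at hy
    · rw [IsoOrth, hsum, hdiff, hx, hy]
    · rw [hsum, hy, smul_eq_mul,
        show (τ + υ) • (2⁻¹ : ℝ) • (y + x) + (υ - τ) • (2⁻¹ : ℝ) • (y - x) = τ • x + υ • y by
          module,
        show (υ - τ) • (2⁻¹ : ℝ) • (y + x) - (τ + υ) • (2⁻¹ : ℝ) • (y - x) = υ • x - τ • y by
          module]
      field_simp
end

section
/- Let X be a nontrivial real Banach space and let τ, υ > 0. Then (4·min{τ,υ}²/υ²)·C′_NJ(X) ≤ L^I_YJ(τ, υ, X) ≤ 4(τ−υ)²/υ² + (8τ²/υ²)·C_NJ(X). -/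
section NormedSpaceLemmas

variable {X : Type*} [NormedAddCommGroup X]

lemma sq_norm_add_add_sq_norm_sub_le (x y : X) :
    ‖x + y‖ ^ 2 + ‖x - y‖ ^ 2 ≤ 2 * (2 * ‖x‖ ^ 2 + 2 * ‖y‖ ^ 2) := by
  have h₁ := pow_le_pow_left₀ (norm_nonneg _) (norm_add_le x y) 2
  have h₂ := pow_le_pow_left₀ (norm_nonneg _) (norm_sub_le x y) 2
  nlinarith [sq_nonneg (‖x‖ - ‖y‖)]

lemma sq_norm_add_add_sq_norm_sub_le_CNJ (x y : X) :
    ‖x + y‖ ^ 2 + ‖x - y‖ ^ 2 ≤ CNJ X * (2 * ‖x‖ ^ 2 + 2 * ‖y‖ ^ 2) := by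
  by_cases h : (x, y) = (0, 0)
  · simp_all
  have hpos : 0 < 2 * ‖x‖ ^ 2 + 2 * ‖y‖ ^ 2 := by
    rcases eq_or_ne x 0 with rfl | hx
    · have : y ≠ 0 := by rintro rfl; exact h rfl
      have := norm_pos_iff.2 this
      positivity
    · have := norm_pos_iff.2 hx
      positivity
  rw [← div_le_iff₀ hpos]
  refine le_csSup ⟨2, ?_⟩ ⟨x, y, h, rfl⟩
  rintro r ⟨a, b, -, rfl⟩
  exact div_le_of_le_mul₀ (by positivity) (by norm_num) (sq_norm_add_add_sq_norm_sub_le a b)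

variable [NormedSpace ℝ X]

lemma sq_norm_smul_add_smul_le (a b : ℝ) (u v : X) :
    ‖a • u + b • v‖ ^ 2 ≤ 2 * (a - b) ^ 2 * ‖u‖ ^ 2 + 2 * b ^ 2 * ‖u + v‖ ^ 2 := by
  have h : ‖a • u + b • v‖ ≤ |a - b| * ‖u‖ + |b| * ‖u + v‖ := by
    calc ‖a • u + b • v‖ = ‖(a - b) • u + b • (u + v)‖ := by congr 1; module
      _ ≤ _ := by
        simpa only [norm_smul, Real.norm_eq_abs] using norm_add_le ((a - b) • u) (b • (u + v))
  have h₂ := (pow_le_pow_left₀ (norm_nonneg _) h 2).trans (add_sq_le ..)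
  rw [mul_pow, mul_pow, sq_abs, sq_abs] at h₂
  linarith

/-- For unit vectors, the skew sum of squares dominates the symmetric one scaled by the smaller
coefficient. -/
lemma sq_mul_sq_norm_add_add_sq_norm_sub_le {m M : ℝ} (hm : 0 ≤ m) (hmM : m ≤ M) {u v : X}
    (hu : ‖u‖ = 1) (hv : ‖v‖ = 1) :
    m ^ 2 * (‖u + v‖ ^ 2 + ‖u - v‖ ^ 2) ≤ ‖M • u + m • v‖ ^ 2 + ‖M • v - m • u‖ ^ 2 := by
  have hM : 0 ≤ M := hm.trans hmM
  have hsub : 0 ≤ M - m := sub_nonneg.2 hmM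
  have hp : M * ‖u + v‖ ≤ ‖M • u + m • v‖ + (M - m) := by
    calc M * ‖u + v‖ = ‖(M • u + m • v) + (M - m) • v‖ := by
          rw [← norm_smul_of_nonneg hM]; congr 1; module
      _ ≤ _ := by
        simpa [norm_smul_of_nonneg hsub, hv] using norm_add_le (M • u + m • v) ((M - m) • v)
  have hq : M * ‖u - v‖ ≤ ‖M • v - m • u‖ + (M - m) := by
    calc M * ‖u - v‖ = ‖(M • v - m • u) - (M - m) • u‖ := by
          rw [norm_sub_rev, ← norm_smul_of_nonneg hM]; congr 1; module
      _ ≤ _ := by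
        simpa [norm_smul_of_nonneg hsub, hu] using norm_sub_le (M • v - m • u) ((M - m) • u)
  have hab : 2 ≤ ‖u + v‖ + ‖u - v‖ := by
    calc (2 : ℝ) = ‖(u + v) + (u - v)‖ := by
          rw [show (u + v) + (u - v) = (2 : ℝ) • u by module, norm_smul, hu]; norm_num
      _ ≤ _ := norm_add_le _ _
  have ha := norm_nonneg (u + v)
  have hb := norm_nonneg (u - v)
  generalize ‖u + v‖ = a at *
  generalize ‖u - v‖ = b at *
  generalize ‖M • u + m • v‖ = p at *
  generalize ‖M • v - m • u‖ = q at *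
  have h₁ : 0 ≤ m * a * (p + (M - m) - M * a) := mul_nonneg (mul_nonneg hm ha) (by linarith)
  have h₂ : 0 ≤ m * b * (q + (M - m) - M * b) := mul_nonneg (mul_nonneg hm hb) (by linarith)
  have h₃ : 0 ≤ m * (M - m) * (a ^ 2 + b ^ 2 - a - b) :=
    mul_nonneg (mul_nonneg hm hsub) (by nlinarith [sq_nonneg (a - b)])
  nlinarith [sq_nonneg (p - m * a), sq_nonneg (q - m * b)]

lemma sq_min_mul_sq_norm_add_add_sq_norm_sub_le {τ υ : ℝ} (hτ : 0 ≤ τ) (hυ : 0 ≤ υ) {u v : X}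
    (hu : ‖u‖ = 1) (hv : ‖v‖ = 1) :
    min τ υ ^ 2 * (‖u + v‖ ^ 2 + ‖u - v‖ ^ 2) ≤ ‖υ • u + τ • v‖ ^ 2 + ‖υ • v - τ • u‖ ^ 2 := by
  rcases le_total τ υ with h | h
  · rw [min_eq_left h]
    exact sq_mul_sq_norm_add_add_sq_norm_sub_le hτ h hu hv
  · rw [min_eq_right h, add_comm u v, norm_sub_rev u v, add_comm (υ • u), norm_sub_rev (υ • v)]
    exact sq_mul_sq_norm_add_add_sq_norm_sub_le hυ h hv hu

lemma div_le_of_isoOrth {τ υ : ℝ} (hυ : 0 < υ) {x y : X} (hxy : (x, y) ≠ (0, 0))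
    (h : IsoOrth x y) :
    (‖(τ + υ) • x + (υ - τ) • y‖ ^ 2 + ‖(υ - τ) • x - (τ + υ) • y‖ ^ 2) /
      (υ ^ 2 * ‖x + y‖ ^ 2) ≤ 4 * (τ - υ) ^ 2 / υ ^ 2 + 8 * τ ^ 2 / υ ^ 2 * CNJ X := by
  have hne : x + y ≠ 0 := by
    intro h₀
    have h₁ : x - y = 0 := by rw [← norm_eq_zero, ← h, h₀, norm_zero]
    have hx : x = 0 := by
      rw [show x = (1 / 2 : ℝ) • ((x + y) + (x - y)) by module, h₀, h₁]; simp
    subst hx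
    simp_all
  have hpos : 0 < ‖x + y‖ := norm_pos_iff.2 hne
  have e₁ : (τ + υ) • x + (υ - τ) • y = υ • (x + y) + τ • (x - y) := by module
  have e₂ : (υ - τ) • x - (τ + υ) • y = υ • (x - y) + τ • (-(x + y)) := by module
  have h₁ := sq_norm_smul_add_smul_le υ τ (x + y) (x - y)
  have h₂ := sq_norm_smul_add_smul_le υ τ (x - y) (-(x + y))
  have h₃ := sq_norm_add_add_sq_norm_sub_le_CNJ (x + y) (x - y)
  rw [← sub_eq_add_neg (x - y), norm_sub_rev (x - y)] at h₂
  have h' : ‖x - y‖ = ‖x + y‖ := h.symm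
  rw [h'] at h₂ h₃
  rw [e₁, e₂, div_le_iff₀ (by positivity)]
  calc _ ≤ 4 * (υ - τ) ^ 2 * ‖x + y‖ ^ 2 + 2 * τ ^ 2 *
        (‖x + y + (x - y)‖ ^ 2 + ‖x + y - (x - y)‖ ^ 2) := by linarith
    _ ≤ 4 * (υ - τ) ^ 2 * ‖x + y‖ ^ 2 + 2 * τ ^ 2 *
        (CNJ X * (2 * ‖x + y‖ ^ 2 + 2 * ‖x + y‖ ^ 2)) := by gcongr
    _ = _ := by field_simp; ring

lemma div_le_LIYJ {τ υ : ℝ} (hυ : 0 < υ) {u v : X} (hu : ‖u‖ = 1) (hv : ‖v‖ = 1) :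
    (‖υ • u + τ • v‖ ^ 2 + ‖υ • v - τ • u‖ ^ 2) / υ ^ 2 ≤ LIYJ X τ υ := by
  refine le_csSup ⟨4 * (τ - υ) ^ 2 / υ ^ 2 + 8 * τ ^ 2 / υ ^ 2 * CNJ X, ?_⟩
    ⟨(1 / 2 : ℝ) • (u + v), (1 / 2 : ℝ) • (u - v), ?_⟩
  · rintro r ⟨x, y, hxy, h, rfl⟩
    exact div_le_of_isoOrth hυ hxy h
  have e₁ : (1 / 2 : ℝ) • (u + v) + (1 / 2 : ℝ) • (u - v) = u := by module
  have e₂ : (1 / 2 : ℝ) • (u + v) - (1 / 2 : ℝ) • (u - v) = v := by module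
  refine ⟨fun h => ?_, by rw [IsoOrth, e₁, e₂, hu, hv], ?_⟩
  · rw [Prod.mk.injEq] at h
    rw [h.1, h.2, add_zero] at e₁
    rw [← e₁, norm_zero] at hu
    exact zero_ne_one hu
  · have e₃ : (τ + υ) • (1 / 2 : ℝ) • (u + v) + (υ - τ) • (1 / 2 : ℝ) • (u - v) =
        υ • u + τ • v := by module
    have e₄ : (υ - τ) • (1 / 2 : ℝ) • (u + v) - (τ + υ) • (1 / 2 : ℝ) • (u - v) =
        υ • v - τ • u := by module
    rw [e₁, e₃, e₄, hu, one_pow, mul_one]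

end NormedSpaceLemmas

/-- `(4·min{τ,υ}²/υ²)·C′_NJ(X) ≤ L^I_YJ(τ, υ, X)
≤ 4(τ−υ)²/υ² + (8τ²/υ²)·C_NJ(X)`. -/
theorem stmt16 (X : Type*) [NormedAddCommGroup X] [NormedSpace ℝ X] [CompleteSpace X]
    [Nontrivial X] (τ υ : ℝ) (hτ : 0 < τ) (hυ : 0 < υ) :
    4 * min τ υ ^ 2 / υ ^ 2 * CNJmod X ≤ LIYJ X τ υ ∧
      LIYJ X τ υ ≤ 4 * (τ - υ) ^ 2 / υ ^ 2 + 8 * τ ^ 2 / υ ^ 2 * CNJ X := by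
  obtain ⟨w, hw⟩ := exists_norm_eq X zero_le_one
  constructor
  · have hυ2 : 0 < υ ^ 2 := by positivity
    have hc : 0 < 4 * min τ υ ^ 2 / υ ^ 2 := by
      have := lt_min hτ hυ
      positivity
    rw [← le_div_iff₀' hc]
    refine csSup_le ⟨_, w, w, hw, hw, rfl⟩ ?_
    rintro r ⟨u, v, hu, hv, rfl⟩
    rw [le_div_iff₀' hc]
    refine le_trans ?_ (div_le_LIYJ hυ hu hv)
    rw [div_mul_eq_mul_div]
    gcongr
    linarith [sq_min_mul_sq_norm_add_add_sq_norm_sub_le hτ.le hυ.le hu hv]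
  · refine csSup_le ⟨_, w, 0, ?_, by simp [IsoOrth], rfl⟩ ?_
    · intro h
      rw [(Prod.mk.inj h).1, norm_zero] at hw
      exact zero_ne_one hw
    · rintro r ⟨x, y, hxy, h, rfl⟩
      exact div_le_of_isoOrth hυ hxy h
end

section
/- Let X be a nontrivial real Banach space. Then sup{(1+λ)/‖x+λy‖ : x, y ∈ S_X, λ ≥ 0, x ⊥_I λy} = sup{(‖x‖+‖y‖)/‖x+y‖ : x, y ∈ X, (x,y) ≠ (0,0), x ⊥_I y}; that is, the unit-sphere form of H̃(X) coincides with its whole-space form. -/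
/-- Every vector is its norm times a unit vector. -/
theorem exists_unit_smul_eq {X : Type*} [NormedAddCommGroup X] [NormedSpace ℝ X] [Nontrivial X]
    (y : X) : ∃ v : X, ‖v‖ = 1 ∧ ‖y‖ • v = y := by
  by_cases hy : y = 0
  · obtain ⟨u, hu⟩ := exists_norm_eq X zero_le_one
    exact ⟨u, hu, by simp [hy]⟩
  · have hy' : ‖y‖ ≠ 0 := norm_ne_zero_iff.2 hy
    exact ⟨‖y‖⁻¹ • y, by rw [norm_smul, norm_inv, norm_norm, inv_mul_cancel₀ hy'],
      smul_inv_smul₀ hy' y⟩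

/-- the unit-sphere form of `H̃(X)` coincides with its
whole-space form. -/
theorem stmt17 (X : Type*) [NormedAddCommGroup X] [NormedSpace ℝ X] [CompleteSpace X]
    [Nontrivial X] :
    sSup {r : ℝ | ∃ x y : X, ∃ l : ℝ, ‖x‖ = 1 ∧ ‖y‖ = 1 ∧ 0 ≤ l ∧
        IsoOrth x (l • y) ∧ r = (1 + l) / ‖x + l • y‖} =
      sSup {r : ℝ | ∃ x y : X, (x, y) ≠ (0, 0) ∧ IsoOrth x y ∧
        r = (‖x‖ + ‖y‖) / ‖x + y‖} := by
  congr 1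
  ext r
  constructor
  · rintro ⟨x, y, l, hx, hy, hl, h, rfl⟩
    refine ⟨x, l • y, ?_, h, ?_⟩
    · intro h0
      have hx0 : x = 0 := (Prod.mk.inj h0).1
      simp [hx0] at hx
    · rw [norm_smul, hx, hy, mul_one, Real.norm_of_nonneg hl]
  · rintro ⟨x, y, h0, h, rfl⟩
    by_cases hx : x = 0
    · subst hx
      have hy : ‖y‖ ≠ 0 := norm_ne_zero_iff.2 fun hy => h0 (by rw [hy])
      obtain ⟨u, hu⟩ := exists_norm_eq X zero_le_one
      exact ⟨u, u, 0, hu, hu, le_rfl, by simp [IsoOrth], by simp [hu, hy]⟩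
    · have hx' : ‖x‖ ≠ 0 := norm_ne_zero_iff.2 hx
      obtain ⟨v, hv, hyv⟩ := exists_unit_smul_eq y
      have hl : (‖y‖ / ‖x‖) • v = ‖x‖⁻¹ • y := by
        conv_rhs => rw [← hyv]
        rw [smul_smul, div_eq_inv_mul]
      refine ⟨‖x‖⁻¹ • x, v, ‖y‖ / ‖x‖, by rw [norm_smul, norm_inv, norm_norm, inv_mul_cancel₀ hx'], hv, by positivity, ?_, ?_⟩
      · unfold IsoOrth at h ⊢
        rw [hl, ← smul_add, ← smul_sub, norm_smul, norm_smul, h]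
      · rw [hl, ← smul_add, norm_smul, norm_inv, norm_norm,
          ← mul_div_mul_left _ _ (inv_ne_zero hx')]
        congr 1
        field_simp
end
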